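/- arXiv:1407.3312 — 2 statements merged into one kernel-verified Lean document; each statement's English description precedes it below -/
import Mathlib

section
/- Let m,n ≥ 2, X = {1,...,m} × {1,...,n}, P the partition of X into blocks C_i = {i} × {1,...,n}, and S = E(X,P) the submonoid of T(X,P) generated by its idempotents. Then the rank of S and the idempotent rank of S are equal, and both equal m·ρ_n + n!·(m choose 2), where ρ_2 = 2 and ρ_n = (n choose 2) for n ≥ 3. -/
/-- `BP f` says that `f : X → X`, with `X = {1,…,m} × {1,…,n}`, preserves the partition of
`X` into the blocks `C_i = {i} × {1,…,n}`, i.e. `f ∈ T(X,P)`. -/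
def BP {m n : ℕ} (f : Fin m × Fin n → Fin m × Fin n) : Prop :=
  ∀ i : Fin m, ∃ j : Fin m, ∀ x : Fin n, (f (i, x)).1 = j

open Function

section Factorization

/-- A nontrivial element of a generated submonoid has a nontrivial generator as right factor. -/
theorem Submonoid.exists_right_factor_of_mem_closure {M : Type*} [Monoid M] {U : Set M} {a : M}
    (ha : a ∈ Submonoid.closure U) (h1 : a ≠ 1) : ∃ u ∈ U, u ≠ 1 ∧ ∃ b, a = b * u := by
  induction ha using Submonoid.closure_induction with
  | mem x hx => exact ⟨x, hx, h1, 1, (one_mul x).symm⟩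
  | one => exact absurd rfl h1
  | mul x y _ _ ihx ihy =>
    by_cases hy : y = 1
    · subst hy
      simpa using ihx (by simpa using h1)
    · obtain ⟨u, hu, hu1, b, rfl⟩ := ihy hy
      exact ⟨u, hu, hu1, x * b, (mul_assoc x b u).symm⟩

/-- A nontrivial element of a generated submonoid has a nontrivial generator as left factor. -/
theorem Submonoid.exists_left_factor_of_mem_closure {M : Type*} [Monoid M] {U : Set M} {a : M}
    (ha : a ∈ Submonoid.closure U) (h1 : a ≠ 1) : ∃ u ∈ U, u ≠ 1 ∧ ∃ b, a = u * b := by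
  induction ha using Submonoid.closure_induction with
  | mem x hx => exact ⟨x, hx, h1, 1, (mul_one x).symm⟩
  | one => exact absurd rfl h1
  | mul x y _ _ ihx ihy =>
    by_cases hx : x = 1
    · subst hx
      simpa using ihy (by simpa using h1)
    · obtain ⟨u, hu, hu1, b, rfl⟩ := ihx hx
      exact ⟨u, hu, hu1, b * y, mul_assoc u b y⟩

end Factorization

/-- The submonoid `E(X,P)` generated by the idempotents of `T(X,P)`. -/
abbrev idempotentGenerated (m n : ℕ) : Submonoid (Function.End (Fin m × Fin n)) :=
  Submonoid.closure {f : Function.End (Fin m × Fin n) | BP f ∧ f * f = f}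

section BlockPreserving

variable {m n : ℕ}

theorem BP.of_mem_idempotentGenerated {f : Function.End (Fin m × Fin n)}
    (hf : f ∈ idempotentGenerated m n) : BP f := by
  induction hf using Submonoid.closure_induction with
  | mem x hx => exact hx.1
  | one => exact fun i => ⟨i, fun _ => rfl⟩
  | mul f g _ _ hf hg =>
    intro i
    obtain ⟨j, hj⟩ := hg i
    obtain ⟨k, hk⟩ := hf j
    refine ⟨k, fun x => ?_⟩
    have h : g (i, x) = (j, (g (i, x)).2) := Prod.ext (hj x) rfl
    change (f (g (i, x))).1 = k
    rw [h]
    exact hk _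

theorem eq_one_of_injective_of_mem_idempotentGenerated {f : Function.End (Fin m × Fin n)}
    (hf : f ∈ idempotentGenerated m n) (hinj : Injective f) : f = 1 := by
  induction hf using Submonoid.closure_induction with
  | mem x hx => exact funext fun p => hinj (congrFun hx.2 p)
  | one => rfl
  | mul f g _ _ hf hg =>
    have h := hg (Injective.of_comp (f := f) hinj)
    subst h
    rw [mul_one] at hinj ⊢
    exact hf hinj

/-- The map sending the point `(i, x)` to `(i, y)` and fixing everything else. -/
def pointMerge (i : Fin m) (x y : Fin n) : Function.End (Fin m × Fin n) :=
  fun p => if p = (i, x) then (i, y) else p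

theorem end_mul_apply {α : Type*} (f g : Function.End α) (p : α) : (f * g) p = f (g p) := rfl

theorem pointMerge_apply_self (i : Fin m) (x y : Fin n) : pointMerge i x y (i, x) = (i, y) :=
  if_pos rfl

theorem pointMerge_apply_of_ne {i : Fin m} {x : Fin n} (y : Fin n) {p : Fin m × Fin n}
    (h : p ≠ (i, x)) : pointMerge i x y p = p :=
  if_neg h

/-- The map sending block `i` to block `j` via `g` and fixing everything else. -/
def blockMerge (i j : Fin m) (g : Fin n → Fin n) : Function.End (Fin m × Fin n) :=
  fun p => if p.1 = i then (j, g p.2) else p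

theorem pointMerge_mul_self (i : Fin m) {x y : Fin n} (h : x ≠ y) :
    pointMerge i x y * pointMerge i x y = pointMerge i x y := by
  funext p
  change pointMerge i x y (pointMerge i x y p) = _
  simp only [pointMerge]
  grind

theorem blockMerge_mul_self {i j : Fin m} (h : i ≠ j) (g : Fin n → Fin n) :
    blockMerge i j g * blockMerge i j g = blockMerge i j g := by
  funext p
  change blockMerge i j g (blockMerge i j g p) = _
  simp only [blockMerge]
  grind

theorem pointMerge_fst (i : Fin m) (x y : Fin n) (p : Fin m × Fin n) :
    (pointMerge i x y p).1 = p.1 := by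
  simp only [pointMerge]
  grind

theorem BP_pointMerge (i : Fin m) (x y : Fin n) : BP (pointMerge i x y) :=
  fun k => ⟨k, fun z => pointMerge_fst i x y (k, z)⟩

theorem BP_blockMerge (i j : Fin m) (g : Fin n → Fin n) : BP (blockMerge i j g) := by
  intro k
  by_cases h : k = i
  · exact ⟨j, fun z => by simp [blockMerge, h]⟩
  · exact ⟨k, fun z => by simp [blockMerge, h]⟩

theorem pointMerge_mem (i : Fin m) {x y : Fin n} (h : x ≠ y) :
    pointMerge i x y ∈ idempotentGenerated m n :=
  Submonoid.subset_closure ⟨BP_pointMerge i x y, pointMerge_mul_self i h⟩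

theorem blockMerge_mem {i j : Fin m} (h : i ≠ j) (g : Fin n → Fin n) :
    blockMerge i j g ∈ idempotentGenerated m n :=
  Submonoid.subset_closure ⟨BP_blockMerge i j g, blockMerge_mul_self h g⟩

theorem pointMerge_ne_one (i : Fin m) {x y : Fin n} (h : x ≠ y) : pointMerge i x y ≠ 1 := by
  intro h1
  have := congrFun h1 (i, x)
  simp [pointMerge] at this
  exact h (congrArg Prod.snd this).symm

theorem blockMerge_ne_one [NeZero n] {i j : Fin m} (h : i ≠ j) (g : Fin n → Fin n) :
    blockMerge i j g ≠ 1 := by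
  intro h1
  have := congrFun h1 (i, 0)
  simp [blockMerge] at this
  exact h (congrArg Prod.fst this).symm

section Generation

variable {M : Submonoid (Function.End (Fin m × Fin n))}

theorem mem_of_forall_apply_eq {f g : Function.End (Fin m × Fin n)} (hg : g ∈ M)
    (h : ∀ p, f p = g p) : f ∈ M :=
  (funext h : f = g) ▸ hg

/-- An idempotent preserving each block is a product of maps moving a single point. -/
theorem mem_of_idempotent_of_fst_eq (hM : ∀ i x y, x ≠ y → pointMerge i x y ∈ M)
    {f : Fin m × Fin n → Fin m × Fin n} (hf : ∀ p, f (f p) = f p) (hb : ∀ p, (f p).1 = p.1) :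
    (f : Function.End (Fin m × Fin n)) ∈ M := by
  have key : ∀ s : Finset (Fin m × Fin n), (∀ p ∈ s, f p ≠ p) →
      (fun p => if p ∈ s then f p else p : Function.End (Fin m × Fin n)) ∈ M := by
    intro s
    induction s using Finset.induction_on with
    | empty => intro _; exact M.one_mem
    | insert q s hq ih =>
      intro hs
      obtain ⟨i, x⟩ := q
      have h1 : (i, (f (i, x)).2) = f (i, x) := Prod.ext (hb (i, x)).symm rfl
      have h2 : x ≠ (f (i, x)).2 := by
        intro h
        exact hs (i, x) (Finset.mem_insert_self _ _) (by rw [← h1, ← h])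
      refine mem_of_forall_apply_eq
        (M.mul_mem (ih fun p hp => hs p (Finset.mem_insert_of_mem hp)) (hM i x _ h2))
        fun p => ?_
      change _ = if pointMerge i x (f (i, x)).2 p ∈ s then f (pointMerge i x (f (i, x)).2 p)
        else pointMerge i x (f (i, x)).2 p
      by_cases hp : p = (i, x)
      · subst hp
        simp [pointMerge_apply_self, h1, hf]
      · simp [pointMerge_apply_of_ne _ hp, hp]
  refine mem_of_forall_apply_eq (key (Finset.univ.filter fun p => f p ≠ p) (by simp)) fun p => ?_
  by_cases hp : f p = p <;> simp [hp]

/-- Every self-map of a finite set is an idempotent followed by a permutation. -/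
theorem exists_perm_comp_idempotent (g : Fin n → Fin n) :
    ∃ (σ : Equiv.Perm (Fin n)) (e : Fin n → Fin n), (∀ x, e (e x) = e x) ∧ g = σ ∘ e := by
  choose s hs using fun y : Set.range g => y.2
  have hgs : ∀ x, g (s ⟨g x, x, rfl⟩) = g x := fun x => hs ⟨g x, x, rfl⟩
  let e : Fin n → Fin n := fun x => s ⟨g x, x, rfl⟩
  have hge : ∀ x, g (e x) = g x := hgs
  have hee : ∀ x y, g x = g y → e x = e y := fun x y h => by simp only [e, h]
  have hinj : Set.InjOn g (Set.range e) := by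
    rintro _ ⟨x, rfl⟩ _ ⟨y, rfl⟩ h
    rw [hge, hge] at h
    exact hee x y h
  obtain ⟨τ, hτ⟩ := Set.MapsTo.exists_equiv_extend_of_card_eq (t := Finset.univ) (by simp)
    (fun _ _ => by simp) hinj
  refine ⟨τ.trans (Equiv.subtypeUnivEquiv fun x => Finset.mem_univ x), e,
    fun x => hee _ _ (hge x), funext fun x => ?_⟩
  exact ((hτ (e x) ⟨x, rfl⟩).trans (hge x)).symm

theorem blockMerge_mem_of_perm (hM : ∀ i x y, x ≠ y → pointMerge i x y ∈ M)
    (hM' : ∀ i j, i ≠ j → ∀ σ : Equiv.Perm (Fin n), blockMerge i j σ ∈ M)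
    {i j : Fin m} (hij : i ≠ j) (g : Fin n → Fin n) : blockMerge i j g ∈ M := by
  obtain ⟨σ, e, he, rfl⟩ := exists_perm_comp_idempotent g
  have h : blockMerge i i e ∈ M := by
    refine mem_of_idempotent_of_fst_eq hM (fun p => ?_) fun p => ?_
    · by_cases hp : p.1 = i <;> simp [blockMerge, hp, he]
    · by_cases hp : p.1 = i <;> simp [blockMerge, hp]
  refine mem_of_forall_apply_eq (M.mul_mem (hM' i j hij σ) h) fun p => ?_
  change _ = blockMerge i j σ (blockMerge i i e p)
  by_cases hp : p.1 = i <;> simp [blockMerge, hp]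

/-- Point merges and bijective block merges generate all idempotents of `T(X,P)`. -/
theorem idempotentGenerated_le (hn : 0 < n) (hM : ∀ i x y, x ≠ y → pointMerge i x y ∈ M)
    (hM' : ∀ i j, i ≠ j → ∀ σ : Equiv.Perm (Fin n), blockMerge i j σ ∈ M) :
    idempotentGenerated m n ≤ M := by
  refine (Submonoid.closure_le).2 ?_
  rintro f ⟨hbp, hf⟩
  have hff : ∀ p, f (f p) = f p := fun p => congrFun hf p
  obtain ⟨b, hb⟩ := Classical.skolem.1 hbp
  have hfb : ∀ p, (f p).1 = b p.1 := fun p => hb p.1 p.2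
  have hbb : ∀ i, b (b i) = b i := by
    intro i
    have h := congrArg Prod.fst (hff (i, ⟨0, hn⟩))
    rwa [hfb, hfb] at h
  have key : ∀ s : Finset (Fin m), (∀ i ∈ s, b i ≠ i) →
      (fun p => if p.1 ∈ s then f p else p : Function.End (Fin m × Fin n)) ∈ M := by
    intro s
    induction s using Finset.induction_on with
    | empty => intro _; exact M.one_mem
    | insert i s hi ih =>
      intro hs
      have h3 := M.mul_mem (ih fun p hp => hs p (Finset.mem_insert_of_mem hp))
        (blockMerge_mem_of_perm hM hM' (hs i (Finset.mem_insert_self _ _)).symm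
          fun x => (f (i, x)).2)
      refine mem_of_forall_apply_eq h3 fun p => ?_
      change _ = if (blockMerge i (b i) (fun x => (f (i, x)).2) p).1 ∈ s
        then f (blockMerge i (b i) (fun x => (f (i, x)).2) p)
        else blockMerge i (b i) (fun x => (f (i, x)).2) p
      obtain ⟨j, x⟩ := p
      by_cases hp : j = i
      · subst hp
        have h4 : b j ∉ s := fun h => hs _ (Finset.mem_insert_of_mem h) (hbb j)
        simp only [Finset.mem_insert_self, blockMerge, if_true, h4, if_false]
        exact Prod.ext (hfb _) rfl
      · simp [blockMerge, hp]
  have hF : (fun p => if b p.1 = p.1 then f p else p : Function.End (Fin m × Fin n)) ∈ M := by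
    refine mem_of_idempotent_of_fst_eq hM (fun p => ?_) fun p => ?_
    · by_cases hp : b p.1 = p.1 <;> simp [hp, hff]
    · by_cases hp : b p.1 = p.1 <;> simp [hp, hfb]
  refine mem_of_forall_apply_eq
    (M.mul_mem hF (key (Finset.univ.filter fun i => b i ≠ i) (by simp))) fun p => ?_
  change f p = if b (if p.1 ∈ Finset.univ.filter fun i => b i ≠ i then f p else p).1 =
    (if p.1 ∈ Finset.univ.filter fun i => b i ≠ i then f p else p).1
    then f (if p.1 ∈ Finset.univ.filter fun i => b i ≠ i then f p else p)
    else (if p.1 ∈ Finset.univ.filter fun i => b i ≠ i then f p else p)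
  by_cases hp : b p.1 = p.1 <;> simp [hp, hff, hfb, hbb]

/-- A directed triangle of point merges yields the reverse of each of its edges. -/
theorem pointMerge_mem_of_triangle {i : Fin m} {a b c : Fin n} (hab : a ≠ b) (hbc : b ≠ c)
    (hca : c ≠ a) (h₁ : pointMerge i a b ∈ M) (h₂ : pointMerge i b c ∈ M)
    (h₃ : pointMerge i c a ∈ M) : pointMerge i b a ∈ M := by
  refine mem_of_forall_apply_eq (M.mul_mem h₂ (M.mul_mem h₃
    (M.mul_mem h₁ (M.mul_mem h₂ (M.mul_mem h₃ h₁))))) fun p => ?_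
  simp only [end_mul_apply]
  have hne : ∀ {x y : Fin n} (z : Fin n), y ≠ x → pointMerge i x z (i, y) = (i, y) :=
    fun z h => pointMerge_apply_of_ne z (by simpa using h)
  by_cases ha : p = (i, a)
  · subst ha
    rw [hne _ hab, pointMerge_apply_self, hne _ hbc, pointMerge_apply_self, hne _ hca,
      pointMerge_apply_self, hne _ hab]
  by_cases hb : p = (i, b)
  · subst hb
    rw [pointMerge_apply_self, hne _ hab.symm, hne _ hbc, pointMerge_apply_self, hne _ hca,
      pointMerge_apply_self, hne _ hab]
  by_cases hc : p = (i, c)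
  · subst hc
    rw [hne _ hbc.symm, hne _ hca, pointMerge_apply_self, hne _ hab, pointMerge_apply_self,
      hne _ hbc, pointMerge_apply_self]
  simp only [pointMerge_apply_of_ne _ ha, pointMerge_apply_of_ne _ hb,
    pointMerge_apply_of_ne _ hc]

/-- The forward block merges by nontrivial permutations together with the trivial backward one
yield all bijective block merges between two blocks. -/
theorem blockMerge_mem_of_choice (hn : 2 ≤ n) {k l : Fin m} (hkl : k ≠ l)
    (h₁ : ∀ σ : Equiv.Perm (Fin n), σ ≠ 1 → blockMerge k l σ ∈ M)
    (h₂ : blockMerge l k (1 : Equiv.Perm (Fin n)) ∈ M) (σ : Equiv.Perm (Fin n)) :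
    blockMerge k l σ ∈ M ∧ blockMerge l k σ ∈ M := by
  constructor
  · by_cases hσ : σ = 1
    · subst hσ
      have : Nontrivial (Fin n) := Fin.nontrivial_iff_two_le.2 hn
      obtain ⟨τ, hτ⟩ := exists_ne (1 : Equiv.Perm (Fin n))
      refine mem_of_forall_apply_eq (M.mul_mem (h₁ τ⁻¹ (inv_ne_one.2 hτ))
        (M.mul_mem h₂ (M.mul_mem (h₁ τ hτ) h₂))) fun p => ?_
      change _ = blockMerge k l ⇑τ⁻¹ (blockMerge l k (1 : Equiv.Perm (Fin n))
        (blockMerge k l τ (blockMerge l k (1 : Equiv.Perm (Fin n)) p)))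
      by_cases hk : p.1 = k
      · simp [blockMerge, hk, hkl]
      · by_cases hl : p.1 = l
        · simp only [blockMerge, hl, hkl.symm]
          simp
          exact Prod.ext hl rfl
        · simp [blockMerge, hk, hl]
    · exact h₁ σ hσ
  · by_cases hσ : σ = 1
    · exact hσ ▸ h₂
    · refine mem_of_forall_apply_eq (M.mul_mem h₂ (M.mul_mem (h₁ σ hσ)
        (M.mul_mem h₂ (h₁ σ⁻¹ (inv_ne_one.2 hσ))))) fun p => ?_
      change _ = blockMerge l k (1 : Equiv.Perm (Fin n)) (blockMerge k l σ
        (blockMerge l k (1 : Equiv.Perm (Fin n)) (blockMerge k l ⇑σ⁻¹ p)))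
      by_cases hk : p.1 = k
      · simp only [blockMerge, hk, hkl]
        simp
        exact Prod.ext hk rfl
      · by_cases hl : p.1 = l
        · simp [blockMerge, hl, hkl.symm]
        · simp [blockMerge, hk, hl]

end Generation

/-- The increasing pairs of elements of `Fin N`. -/
def ltPairs (N : ℕ) : Finset (Fin N × Fin N) := Finset.univ.filter fun p => p.1 < p.2

theorem mem_ltPairs {N : ℕ} {p : Fin N × Fin N} : p ∈ ltPairs N ↔ p.1 < p.2 := by
  simp [ltPairs]

theorem card_ltPairs (N : ℕ) : (ltPairs N).card = N.choose 2 := by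
  have h : (ltPairs N).card = ∑ j : Fin N, (Finset.Iio j).card := by
    rw [← Finset.card_sigma]
    refine Finset.card_bij' (fun p _ => ⟨p.2, p.1⟩) (fun q _ => (q.2, q.1)) ?_ ?_ ?_ ?_ <;>
      simp [mem_ltPairs]
  rw [h]
  simp only [Fin.card_Iio]
  rw [Fin.sum_univ_eq_sum_range (fun j => j), Finset.sum_range_id, Nat.choose_two_right]

section LowerBound

variable {U : Finset (Function.End (Fin m × Fin n))}

theorem exists_not_injective_right_factor
    (hU : Submonoid.closure (U : Set (Function.End (Fin m × Fin n))) = idempotentGenerated m n)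
    {a : Function.End (Fin m × Fin n)} (ha : a ∈ idempotentGenerated m n) (h1 : a ≠ 1) :
    ∃ u ∈ U, u ∈ idempotentGenerated m n ∧ (∃ p q, p ≠ q ∧ u p = u q) ∧
      ∀ p q, u p = u q → a p = a q := by
  obtain ⟨u, hu, hu1, b, hb⟩ := Submonoid.exists_right_factor_of_mem_closure (hU ▸ ha) h1
  have huS : u ∈ idempotentGenerated m n := hU ▸ Submonoid.subset_closure hu
  refine ⟨u, hu, huS, ?_, fun p q h => ?_⟩
  · have h := mt (eq_one_of_injective_of_mem_idempotentGenerated huS) hu1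
    simp only [Injective, not_forall] at h
    obtain ⟨p, q, h, hne⟩ := h
    exact ⟨p, q, hne, h⟩
  · rw [hb, end_mul_apply, end_mul_apply, h]

theorem exists_not_surjective_left_factor
    (hU : Submonoid.closure (U : Set (Function.End (Fin m × Fin n))) = idempotentGenerated m n)
    {a : Function.End (Fin m × Fin n)} (ha : a ∈ idempotentGenerated m n) (h1 : a ≠ 1) :
    ∃ u ∈ U, u ∈ idempotentGenerated m n ∧ ¬ Surjective u ∧ ∀ p, ∃ q, u q = a p := by
  obtain ⟨u, hu, hu1, b, hb⟩ := Submonoid.exists_left_factor_of_mem_closure (hU ▸ ha) h1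
  have huS : u ∈ idempotentGenerated m n := hU ▸ Submonoid.subset_closure hu
  refine ⟨u, hu, huS, fun h => ?_, fun p => ⟨b p, by rw [hb, end_mul_apply]⟩⟩
  exact hu1 (eq_one_of_injective_of_mem_idempotentGenerated huS (Finite.injective_iff_surjective.2 h))

/-- The map identifies two points of different blocks. -/
def MergesBlocks (f : Function.End (Fin m × Fin n)) : Prop := ∃ p q, p.1 ≠ q.1 ∧ f p = f q

theorem BP.apply_eq_of_blockMerge {f : Fin m × Fin n → Fin m × Fin n} (hf : BP f) {k l : Fin m}
    {σ : Equiv.Perm (Fin n)} (h : ∀ p q, f p = f q → blockMerge k l σ p = blockMerge k l σ q)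
    (hkl : k ≠ l) (hne : ∃ p q, p ≠ q ∧ f p = f q) (x : Fin n) : f (k, x) = f (l, σ x) := by
  have hk : ∀ y, blockMerge k l σ (k, y) = (l, σ y) := fun y => if_pos rfl
  have hi : ∀ i y, i ≠ k → blockMerge k l σ (i, y) = (i, y) := fun i y h => if_neg h
  have hinj : ∀ i y z, f (i, y) = f (i, z) → y = z := by
    intro i y z hyz
    have := h _ _ hyz
    by_cases hik : i = k
    · subst hik
      simpa [hk] using this
    · simpa [hi _ _ hik] using this
  obtain ⟨j, hj⟩ := hf k
  obtain ⟨j', hj'⟩ := hf l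
  have hjj : j = j' := by
    obtain ⟨⟨i, y⟩, ⟨i', z⟩, hpq, hfpq⟩ := hne
    have := h _ _ hfpq
    by_cases hik : i = k
    · by_cases hik' : i' = k
      · subst hik hik'
        exact absurd (by rw [hinj _ _ _ hfpq]) hpq
      · subst hik
        rw [hk, hi _ _ hik', Prod.mk.injEq] at this
        rw [← hj y, ← hj' z, hfpq, this.1]
    · by_cases hik' : i' = k
      · subst hik'
        rw [hk, hi _ _ hik, Prod.mk.injEq] at this
        rw [← hj z, ← hj' y, ← hfpq, this.1]
      · rw [hi _ _ hik, hi _ _ hik'] at this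
        exact absurd this hpq
  subst hjj
  have hsurj : Surjective fun y => (f (l, y)).2 := by
    refine Finite.surjective_of_injective fun y z hyz => hinj l y z (Prod.ext ?_ hyz)
    rw [hj', hj']
  obtain ⟨y, hy⟩ := hsurj (f (k, x)).2
  have hxy : f (k, x) = f (l, y) := Prod.ext ((hj x).trans (hj' y).symm) hy.symm
  have := h _ _ hxy
  rw [hk, hi _ _ hkl.symm, Prod.mk.injEq] at this
  rw [hxy, this.2]

open Classical in
theorem card_mergesBlocks_ge (hn : 0 < n)
    (hU : Submonoid.closure (U : Set (Function.End (Fin m × Fin n))) = idempotentGenerated m n) :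
    n.factorial * m.choose 2 ≤ (U.filter fun f => MergesBlocks f).card := by
  have : NeZero n := ⟨hn.ne'⟩
  have hex : ∀ t : (Fin m × Fin m) × Equiv.Perm (Fin n), ∃ u : Function.End (Fin m × Fin n),
      t.1.1 < t.1.2 → u ∈ U ∧ (∀ x, u (t.1.1, x) = u (t.1.2, t.2 x)) ∧
        ∀ p q, u p = u q → blockMerge t.1.1 t.1.2 t.2 p = blockMerge t.1.1 t.1.2 t.2 q := by
    rintro ⟨⟨k, l⟩, σ⟩
    by_cases hkl : k < l
    · obtain ⟨u, hu, huS, hne, hle⟩ := exists_not_injective_right_factor hU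
        (blockMerge_mem hkl.ne σ) (blockMerge_ne_one hkl.ne σ)
      exact ⟨u, fun _ => ⟨hu, fun x => (BP.of_mem_idempotentGenerated huS).apply_eq_of_blockMerge
        hle hkl.ne hne x, hle⟩⟩
    · exact ⟨1, fun h => absurd h hkl⟩
  choose u hu using hex
  have hcard : (ltPairs m ×ˢ (Finset.univ : Finset (Equiv.Perm (Fin n)))).card =
      n.factorial * m.choose 2 := by
    rw [Finset.card_product, card_ltPairs, Finset.card_univ, Fintype.card_perm, Fintype.card_fin,
      mul_comm]
  rw [← hcard]
  refine Finset.card_le_card_of_injOn u ?_ ?_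
  · rintro ⟨⟨k, l⟩, σ⟩ ht
    have hkl : k < l := by simpa [mem_ltPairs] using ht
    obtain ⟨h1, h2, -⟩ := hu ⟨⟨k, l⟩, σ⟩ hkl
    exact Finset.mem_coe.2 (Finset.mem_filter.2 ⟨h1, (k, 0), (l, σ 0), hkl.ne, h2 0⟩)
  · rintro ⟨⟨k, l⟩, σ⟩ ht ⟨⟨k', l'⟩, σ'⟩ ht' heq
    have hkl : k < l := by simpa [mem_ltPairs] using ht
    have hkl' : k' < l' := by simpa [mem_ltPairs] using ht'
    obtain ⟨-, -, h3⟩ := hu ⟨⟨k, l⟩, σ⟩ hkl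
    obtain ⟨-, h2, -⟩ := hu ⟨⟨k', l'⟩, σ'⟩ hkl'
    rw [← heq] at h2
    have h4 : ∀ x, blockMerge k l σ (k', x) = blockMerge k l σ (l', σ' x) :=
      fun x => h3 _ _ (h2 x)
    have hk : ∀ y, blockMerge k l σ (k, y) = (l, σ y) := fun y => if_pos rfl
    have hi : ∀ i y, i ≠ k → blockMerge k l σ (i, y) = (i, y) := fun i y h => if_neg h
    by_cases hkk : k' = k
    · subst hkk
      simp only [hk, hi _ _ hkl'.ne', Prod.mk.injEq] at h4
      have h5 : σ = σ' := Equiv.ext fun x => (h4 x).2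
      rw [(h4 0).1, h5]
    · have h5 := congrArg Prod.fst (h4 0)
      by_cases hlk : l' = k
      · subst hlk
        rw [hk, hi _ _ hkk] at h5
        change k' = l at h5
        exact absurd (h5 ▸ hkl') hkl.asymm
      · rw [hi _ _ hkk, hi _ _ hlk] at h5
        exact absurd h5 hkl'.ne

open Classical in
theorem card_not_mergesBlocks_ge
    (hU : Submonoid.closure (U : Set (Function.End (Fin m × Fin n))) = idempotentGenerated m n) :
    m * n.choose 2 ≤ (U.filter fun f => ¬ MergesBlocks f).card := by
  have hex : ∀ t : Fin m × Fin n × Fin n, ∃ u : Function.End (Fin m × Fin n),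
      t.2.1 < t.2.2 → u ∈ U ∧ u (t.1, t.2.1) = u (t.1, t.2.2) ∧
        ∀ p q, u p = u q → pointMerge t.1 t.2.1 t.2.2 p = pointMerge t.1 t.2.1 t.2.2 q := by
    rintro ⟨i, x, y⟩
    by_cases hxy : x < y
    · obtain ⟨u, hu, huS, ⟨p, q, hpq, hupq⟩, hle⟩ := exists_not_injective_right_factor hU
        (pointMerge_mem i hxy.ne) (pointMerge_ne_one i hxy.ne)
      refine ⟨u, fun _ => ⟨hu, ?_, hle⟩⟩
      have h := hle p q hupq
      by_cases hp : p = (i, x)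
      · subst hp
        rw [pointMerge_apply_self, pointMerge_apply_of_ne _ hpq.symm] at h
        exact h ▸ hupq
      · by_cases hq : q = (i, x)
        · subst hq
          rw [pointMerge_apply_self, pointMerge_apply_of_ne _ hpq] at h
          exact h ▸ hupq.symm
        · rw [pointMerge_apply_of_ne _ hp, pointMerge_apply_of_ne _ hq] at h
          exact absurd h hpq
    · exact ⟨1, fun h => absurd h hxy⟩
  choose u hu using hex
  have hcard : ((Finset.univ : Finset (Fin m)) ×ˢ ltPairs n).card = m * n.choose 2 := by
    rw [Finset.card_product, card_ltPairs, Finset.card_univ, Fintype.card_fin]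
  rw [← hcard]
  refine Finset.card_le_card_of_injOn u ?_ ?_
  · rintro ⟨i, x, y⟩ ht
    have hxy : x < y := by simpa [mem_ltPairs] using ht
    obtain ⟨h1, -, h3⟩ := hu ⟨i, x, y⟩ hxy
    refine Finset.mem_coe.2 (Finset.mem_filter.2 ⟨h1, ?_⟩)
    rintro ⟨p, q, hpq, h⟩
    have h4 := congrArg Prod.fst (h3 p q h)
    rw [pointMerge_fst, pointMerge_fst] at h4
    exact hpq h4
  · rintro ⟨i, x, y⟩ ht ⟨i', x', y'⟩ ht' heq
    have hxy : x < y := by simpa [mem_ltPairs] using ht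
    have hxy' : x' < y' := by simpa [mem_ltPairs] using ht'
    obtain ⟨-, -, h3⟩ := hu ⟨i, x, y⟩ hxy
    obtain ⟨-, h2, -⟩ := hu ⟨i', x', y'⟩ hxy'
    rw [← heq] at h2
    have h4 := h3 _ _ h2
    simp only [pointMerge, Prod.mk.injEq] at h4
    grind

open Classical in
theorem card_not_mergesBlocks_ge_of_eq_two (hn : n = 2)
    (hU : Submonoid.closure (U : Set (Function.End (Fin m × Fin n))) = idempotentGenerated m n) :
    m * 2 ≤ (U.filter fun f => ¬ MergesBlocks f).card := by
  subst hn
  have hex : ∀ t : Fin m × Fin 2, ∃ u : Function.End (Fin m × Fin 2),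
      u ∈ U ∧ u ∈ idempotentGenerated m 2 ∧ ∀ p, p ≠ t ↔ ∃ q, u q = p := by
    rintro ⟨i, x⟩
    obtain ⟨y, hxy⟩ : ∃ y, x ≠ y := ⟨x + 1, by fin_cases x <;> simp⟩
    obtain ⟨u, hu, huS, hns, hle⟩ := exists_not_surjective_left_factor hU
        (pointMerge_mem i hxy) (pointMerge_ne_one i hxy)
    have h1 : ∀ p, p ≠ (i, x) → ∃ q, u q = p := by
      intro p hp
      have h := hle p
      rwa [pointMerge_apply_of_ne _ hp] at h
    refine ⟨u, hu, huS, fun p => ⟨h1 p, ?_⟩⟩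
    rintro ⟨q, rfl⟩ hq
    refine hns fun p => ?_
    by_cases hp : p = (i, x)
    · exact ⟨q, hq.trans hp.symm⟩
    · exact h1 p hp
  choose u hu huS hrange using hex
  have hcard : (Finset.univ : Finset (Fin m × Fin 2)).card = m * 2 := by simp
  rw [← hcard]
  refine Finset.card_le_card_of_injOn u ?_ ?_
  · intro t _
    refine Finset.mem_coe.2 (Finset.mem_filter.2 ⟨hu t, ?_⟩)
    rintro ⟨p, q, hpq, h⟩
    obtain ⟨b, hb⟩ := Classical.skolem.1 (BP.of_mem_idempotentGenerated (huS t))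
    have hub : ∀ p, (u t p).1 = b p.1 := fun p => hb p.1 p.2
    have hns : ¬ Surjective b := fun hs => hpq (Finite.injective_iff_surjective.2 hs (by
      rw [← hub, ← hub, h]))
    simp only [Surjective, not_forall, not_exists] at hns
    obtain ⟨j, hj⟩ := hns
    have hjt : ∀ z, (j, z) = t := by
      intro z
      by_contra hne
      obtain ⟨q, hq⟩ := (hrange t (j, z)).1 hne
      exact hj q.1 (by rw [← hub, hq])
    have h01 := (hjt 0).trans (hjt 1).symm
    simp at h01
  · intro t _ t' _ heq
    by_contra hne
    have h := (hrange t' t).1 hne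
    rw [← heq] at h
    exact (hrange t t).2 h rfl

theorem card_ge_of_closure_eq (hn : 0 < n)
    (hU : Submonoid.closure (U : Set (Function.End (Fin m × Fin n))) = idempotentGenerated m n) :
    m * (if n = 2 then 2 else n.choose 2) + n.factorial * m.choose 2 ≤ U.card := by
  classical
  rw [← Finset.card_filter_add_card_filter_not (s := U) fun f => MergesBlocks f, add_comm]
  refine Nat.add_le_add (card_mergesBlocks_ge hn hU) ?_
  split_ifs with h
  · convert card_not_mergesBlocks_ge_of_eq_two h hU
  · convert card_not_mergesBlocks_ge hU

end LowerBound

section Generators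

/-- Arcs of a tournament on `Fin n` (both arcs for `n = 2`): the natural order with the pair of
extreme elements reversed. -/
theorem exists_arcs (m : ℕ) (hn : 2 ≤ n) : ∃ A : Finset (Fin n × Fin n),
    A.card ≤ (if n = 2 then 2 else n.choose 2) ∧ (∀ a ∈ A, a.1 ≠ a.2) ∧
    ∀ (M : Submonoid (Function.End (Fin m × Fin n))) (i : Fin m),
      (∀ a ∈ A, pointMerge i a.1 a.2 ∈ M) → ∀ x y, x ≠ y → pointMerge i x y ∈ M := by
  by_cases h2 : n = 2
  · subst h2
    exact ⟨Finset.univ.filter fun a => a.1 ≠ a.2, by decide, by simp,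
      fun M i h x y hxy => h (x, y) (by simpa using hxy)⟩
  rw [if_neg h2]
  let z : Fin n := ⟨0, by omega⟩
  let w : Fin n := ⟨n - 1, by omega⟩
  have hzw : z ≠ w := by simp [z, w]; omega
  refine ⟨(ltPairs n).image fun a => if a = (z, w) then (w, z) else a,
    Finset.card_image_le.trans (card_ltPairs n).le, ?_, ?_⟩
  · intro a ha
    obtain ⟨b, hb, rfl⟩ := Finset.mem_image.1 ha
    rw [mem_ltPairs] at hb
    split_ifs
    · exact hzw.symm
    · exact hb.ne
  intro M i hA
  have hlt : ∀ x y, x < y → (x, y) ≠ (z, w) → pointMerge i x y ∈ M := fun x y hxy hne =>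
    hA (x, y) (Finset.mem_image.2 ⟨(x, y), mem_ltPairs.2 hxy, if_neg hne⟩)
  have hwz : pointMerge i w z ∈ M := hA (w, z) (Finset.mem_image.2
    ⟨(z, w), mem_ltPairs.2 (show z < w by simp [z, w, Fin.lt_def]; omega), if_pos rfl⟩)
  have hz : ∀ x, x ≠ z → z < x := fun x hx => by
    have := Fin.val_ne_of_ne hx
    simp only [z, Fin.lt_def] at *
    omega
  have hw : ∀ x, x ≠ w → x < w := fun x hx => by
    have := Fin.val_ne_of_ne hx
    simp only [w, Fin.lt_def] at *
    omega
  have hzx : ∀ x, x ≠ z → x ≠ w → pointMerge i z x ∈ M := fun x h h' =>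
    hlt z x (hz x h) (by simp [h'])
  have hxw : ∀ x, x ≠ z → x ≠ w → pointMerge i x w ∈ M := fun x h h' =>
    hlt x w (hw x h') (by simp [h])
  have hxz : ∀ x, x ≠ z → pointMerge i x z ∈ M := by
    intro x h
    by_cases h' : x = w
    · exact h' ▸ hwz
    · exact pointMerge_mem_of_triangle h.symm h' hzw.symm (hzx x h h') (hxw x h h') hwz
  have hwx : ∀ x, x ≠ z → x ≠ w → pointMerge i w x ∈ M := fun x h h' =>
    pointMerge_mem_of_triangle h' hzw.symm h.symm (hxw x h h') hwz (hzx x h h')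
  have hzw' : pointMerge i z w ∈ M := by
    let v : Fin n := ⟨1, by omega⟩
    have hv : v ≠ z := by simp [z, v]
    have hv' : v ≠ w := by simp [w, v]; omega
    exact pointMerge_mem_of_triangle hzw.symm hv.symm hv' hwz (hzx v hv hv') (hxw v hv hv')
  intro x y hxy
  rcases lt_or_gt_of_ne hxy with h | h
  · by_cases he : (x, y) = (z, w)
    · simp only [Prod.mk.injEq] at he
      exact he.1 ▸ he.2 ▸ hzw'
    · exact hlt x y h he
  · by_cases hy : y = z
    · exact hy ▸ hxz x (hy ▸ hxy)
    by_cases hx : x = w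
    · subst hx
      exact hwx y hy h.ne
    have hxz' : x ≠ z := fun h' => absurd (h' ▸ h) (hz y hy).asymm
    exact pointMerge_mem_of_triangle hxy.symm hxz' (Ne.symm hy)
      (hlt y x h (by simp [hy])) (hxz x hxz') (hzx y hy (h.trans (hw x hx)).ne)

theorem exists_idempotent_generators (hn : 2 ≤ n) :
    ∃ U : Finset (Function.End (Fin m × Fin n)), (∀ f ∈ U, f * f = f) ∧
      Submonoid.closure (U : Set (Function.End (Fin m × Fin n))) = idempotentGenerated m n ∧
      U.card ≤ m * (if n = 2 then 2 else n.choose 2) + n.factorial * m.choose 2 := by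
  classical
  obtain ⟨A, hAcard, hAne, hAgen⟩ := exists_arcs m hn
  let V : Finset (Function.End (Fin m × Fin n)) :=
    ((Finset.univ : Finset (Fin m)) ×ˢ A).image fun t => pointMerge t.1 t.2.1 t.2.2
  let W : Finset (Function.End (Fin m × Fin n)) :=
    ((Finset.univ : Finset (Equiv.Perm (Fin n))) ×ˢ ltPairs m).image fun t =>
      if t.1 = 1 then blockMerge t.2.2 t.2.1 t.1 else blockMerge t.2.1 t.2.2 t.1
  have hVW : ∀ f ∈ V ∪ W, BP f ∧ f * f = f := by
    intro f hf
    rcases Finset.mem_union.1 hf with hf | hf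
    · obtain ⟨⟨i, x, y⟩, ht, rfl⟩ := Finset.mem_image.1 hf
      exact ⟨BP_pointMerge i x y, pointMerge_mul_self i (hAne _ (Finset.mem_product.1 ht).2)⟩
    · obtain ⟨⟨σ, k, l⟩, ht, rfl⟩ := Finset.mem_image.1 hf
      have hkl : k < l := mem_ltPairs.1 (Finset.mem_product.1 ht).2
      dsimp only
      split_ifs
      · exact ⟨BP_blockMerge l k σ, blockMerge_mul_self hkl.ne' σ⟩
      · exact ⟨BP_blockMerge k l σ, blockMerge_mul_self hkl.ne σ⟩
  refine ⟨V ∪ W, fun f hf => (hVW f hf).2, le_antisymm ?_ ?_, ?_⟩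
  · exact Submonoid.closure_mono fun f hf => hVW f hf
  · have hV : ∀ f ∈ V, f ∈ Submonoid.closure ((V ∪ W : Finset _) : Set _) := fun f hf =>
      Submonoid.subset_closure (Finset.mem_coe.2 (Finset.mem_union_left W hf))
    have hW : ∀ f ∈ W, f ∈ Submonoid.closure ((V ∪ W : Finset _) : Set _) := fun f hf =>
      Submonoid.subset_closure (Finset.mem_coe.2 (Finset.mem_union_right V hf))
    have hkl : ∀ k l : Fin m, k < l → ∀ σ : Equiv.Perm (Fin n),
        blockMerge k l σ ∈ Submonoid.closure ((V ∪ W : Finset _) : Set _) ∧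
        blockMerge l k σ ∈ Submonoid.closure ((V ∪ W : Finset _) : Set _) := by
      intro k l h
      refine blockMerge_mem_of_choice hn h.ne (fun σ hσ => hW _ ?_) (hW _ ?_)
      · exact Finset.mem_image.2 ⟨(σ, k, l), by simpa [mem_ltPairs] using h, if_neg hσ⟩
      · exact Finset.mem_image.2 ⟨(1, k, l), by simpa [mem_ltPairs] using h, if_pos rfl⟩
    refine idempotentGenerated_le (by omega) (fun i => hAgen _ i fun a ha => hV _ ?_) ?_
    · exact Finset.mem_image.2 ⟨(i, a), by simpa using ha, rfl⟩
    · intro i j hij σ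
      rcases lt_or_gt_of_ne hij with h | h
      · exact (hkl i j h σ).1
      · exact (hkl j i h σ).2
  · refine (Finset.card_union_le V W).trans (Nat.add_le_add (Finset.card_image_le.trans ?_)
      (Finset.card_image_le.trans ?_))
    · rw [Finset.card_product, Finset.card_univ, Fintype.card_fin]
      exact Nat.mul_le_mul_left m hAcard
    · rw [Finset.card_product, card_ltPairs, Finset.card_univ, Fintype.card_perm,
        Fintype.card_fin]

end Generators

end BlockPreserving

/-- For `m, n ≥ 2`, the rank and the idempotent rank of the submonoid
`S = E(X,P)` of `T(X,P)` generated by its idempotents coincide: both equal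
`m·ρ_n + n!·(m choose 2)`, where `ρ_2 = 2` and `ρ_n = (n choose 2)` for `n ≥ 3`. -/
theorem stmt_17 (m n : ℕ) (hm : 2 ≤ m) (hn : 2 ≤ n) :
    IsLeast {k : ℕ | ∃ U : Finset (Function.End (Fin m × Fin n)),
        Submonoid.closure (U : Set (Function.End (Fin m × Fin n)))
          = Submonoid.closure {f : Function.End (Fin m × Fin n) | BP f ∧ f * f = f}
        ∧ U.card = k}
      (m * (if n = 2 then 2 else n.choose 2) + n.factorial * m.choose 2) ∧
    IsLeast {k : ℕ | ∃ U : Finset (Function.End (Fin m × Fin n)),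
        (∀ f ∈ U, f * f = f) ∧
        Submonoid.closure (U : Set (Function.End (Fin m × Fin n)))
          = Submonoid.closure {f : Function.End (Fin m × Fin n) | BP f ∧ f * f = f}
        ∧ U.card = k}
      (m * (if n = 2 then 2 else n.choose 2) + n.factorial * m.choose 2) := by
  obtain ⟨U, hidem, hgen, hle⟩ := exists_idempotent_generators (m := m) hn
  have hcard := le_antisymm hle (card_ge_of_closure_eq (by omega) hgen)
  refine ⟨⟨⟨U, hgen, hcard⟩, ?_⟩, ⟨⟨U, hidem, hgen, hcard⟩, ?_⟩⟩
  · rintro _ ⟨V, hV, rfl⟩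
    exact card_ge_of_closure_eq (by omega) hV
  · rintro _ ⟨V, -, hV, rfl⟩
    exact card_ge_of_closure_eq (by omega) hV
end

section
/- Let m,n ≥ 2, X = {1,...,m} × {1,...,n}, P the partition of X into blocks C_i = {i} × {1,...,n}, and S = E(X,P) the idempotent-generated submonoid of T(X,P). Let U be a set of idempotents of T(X,P), let 1 ≤ r < s ≤ m, and suppose e_{rs;1} = g_1⋯g_k with g_1,...,g_k ∈ U, where k is minimal among all expressions of e_{rs;1} as a product of elements of U. Then each g_t belongs to G_2 = {e_{ij;f} : i,j ∈ {1,...,m} distinct, f ∈ S_n}. -/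
/-- `eijf i j g = e_{ij;g} = [1,…,1,g,1,…,1; e_{ij}]`, with `g` in the `j`-th position and
where `e_{ij} ∈ T_m` sends `j` to `i` and fixes all other points.  In particular
`eijf r s id = e_{rs;1} = [1,…,1; e_{rs}]`. -/
def eijf {m n : ℕ} (i j : Fin m) (g : Fin n → Fin n) : Function.End (Fin m × Fin n) :=
  fun p => (if p.1 = j then i else p.1, if p.1 = j then g p.2 else p.2)

theorem BP.comp {m n : ℕ} {f g : Fin m × Fin n → Fin m × Fin n} (hf : BP f) (hg : BP g) :
    BP (f ∘ g) := by
  intro i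
  obtain ⟨j, hj⟩ := hg i
  obtain ⟨l, hl⟩ := hf j
  refine ⟨l, fun x => ?_⟩
  have : g (i, x) = (j, (g (i, x)).2) := Prod.ext (hj x) rfl
  rw [Function.comp_apply, this, hl]

theorem BP.list_prod {m n : ℕ} (L : List (Function.End (Fin m × Fin n)))
    (hL : ∀ u ∈ L, BP u) : BP L.prod := by
  induction L with
  | nil => exact fun i => ⟨i, fun _ => rfl⟩
  | cons a L ih =>
    rw [List.prod_cons]
    exact BP.comp (hL a (by simp)) (ih fun u hu => hL u (by simp [hu]))

theorem ncard_setOf_fst_ne {m n : ℕ} (j : Fin m) :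
    {p : Fin m × Fin n | p.1 ≠ j}.ncard = (m - 1) * n := by
  have : {p : Fin m × Fin n | p.1 ≠ j} = ({j}ᶜ : Set (Fin m)) ×ˢ Set.univ := by
    ext p; simp
  rw [this, Set.ncard_prod, Set.ncard_compl, Set.ncard_singleton, Set.ncard_univ]
  simp

/-- An idempotent factor of `e_{rs;1}` which does not fix the image of the preceding factors
pointwise is of the form `e_{ij;f}` with `f` a permutation. -/
theorem exists_eq_eijf_of_factor {m n : ℕ} {r s : Fin m}
    {T u h : Function.End (Fin m × Fin n)} (hu : BP u) (huu : u * u = u) (hh : BP h)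
    (he : T * (u * h) = eijf r s id) (hne : u * h ≠ h) :
    ∃ (i j : Fin m) (f : Fin n → Fin n),
      i ≠ j ∧ Function.Bijective f ∧ u = eijf i j f := by
  have hidem : ∀ p, u (u p) = u p := congrFun huu
  have he' : ∀ p, T (u (h p)) = eijf r s id p := congrFun he
  obtain ⟨⟨a, x₀⟩, hp⟩ : ∃ p, u (h p) ≠ h p := by
    by_contra! hall
    exact hne (funext hall)
  obtain ⟨j, hj⟩ := hh a
  obtain ⟨i, hi⟩ := hu j
  have hhj : ∀ x, h (a, x) = (j, (h (a, x)).2) := fun x => Prod.ext (hj x) rfl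
  have hui : ∀ x, u (j, x) = (i, (u (j, x)).2) := fun x => Prod.ext (hi x) rfl
  have hcomp : Function.Injective fun x => u (h (a, x)) := by
    intro x y hxy
    have hT : eijf r s id (a, x) = eijf r s id (a, y) := by
      rw [← he', ← he']
      exact congrArg T hxy
    simpa [eijf] using congrArg Prod.snd hT
  have hsurj : Function.Surjective fun x => (h (a, x)).2 := by
    refine Finite.injective_iff_surjective.mp fun x y hxy => hcomp ?_
    have : h (a, x) = h (a, y) := Prod.ext ((hj x).trans (hj y).symm) hxy
    exact congrArg u this
  have hinj : Function.Injective fun x => u (j, x) := by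
    intro y z hyz
    obtain ⟨y, rfl⟩ := hsurj y
    obtain ⟨z, rfl⟩ := hsurj z
    simp only [← hhj] at hyz
    rw [hcomp hyz]
  have hij : i ≠ j := by
    rintro rfl
    apply hp
    have hfix : (u (i, (h (a, x₀)).2)).2 = (h (a, x₀)).2 :=
      hinj ((congrArg u (hui _)).symm.trans (hidem _))
    rw [hhj]
    exact Prod.ext (hi _) hfix
  have hsub : Set.range (u * h) ⊆ {p | p.1 ≠ j} := by
    rintro _ ⟨p, rfl⟩ hpj
    have h1 : u (h p) = (j, (u (h p)).2) := Prod.ext hpj rfl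
    have h2 := hidem (h p)
    rw [h1] at h2
    exact hij ((hi _).symm.trans (congrArg Prod.fst h2))
  have himg : {p : Fin m × Fin n | p.1 ≠ s} ⊆ T '' Set.range (u * h) := by
    intro p hps
    refine ⟨_, ⟨p, rfl⟩, (he' p).trans ?_⟩
    have hps' : p.1 ≠ s := hps
    simp [eijf, hps']
  have hrange : Set.range (u * h) = {p | p.1 ≠ j} := by
    refine Set.eq_of_subset_of_ncard_le hsub ?_
    rw [ncard_setOf_fst_ne, ← ncard_setOf_fst_ne s]
    exact (Set.ncard_le_ncard himg).trans (Set.ncard_image_le)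
  refine ⟨i, j, fun x => (u (j, x)).2, hij, ?_, ?_⟩
  · refine Finite.injective_iff_bijective.mp fun x y hxy => hinj ?_
    exact Prod.ext ((hi x).trans (hi y).symm) hxy
  · funext ⟨l, x⟩
    by_cases hl : l = j
    · subst hl
      simpa [eijf] using hui x
    · obtain ⟨p, hp⟩ : (l, x) ∈ Set.range (u * h) := by rw [hrange]; exact hl
      have hux : u (l, x) = (l, x) := by
        rw [← hp]
        exact hidem (h p)
      simp [eijf, hl, hux]

/-- Let `m, n ≥ 2`, let `U` be a set of idempotents of `T(X,P)`, let
`r < s` in `{1,…,m}`, and suppose `e_{rs;1} = g_1⋯g_k` with all `g_t ∈ U` (maps act on the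
right, so this product is the composite `g_k ∘ ⋯ ∘ g_1`, i.e. the product of the reversed
list in `Function.End`), where `k` is minimal among all such expressions of `e_{rs;1}` as a
product of elements of `U`.  Then every `g_t` lies in
`G_2 = {e_{ij;f} : i ≠ j, f ∈ S_n}`. -/
theorem stmt_18 (m n : ℕ) (hm : 2 ≤ m) (hn : 2 ≤ n)
    (U : Set (Function.End (Fin m × Fin n)))
    (hU : ∀ u ∈ U, BP u ∧ u * u = u)
    (r s : Fin m) (hrs : r < s)
    (k : ℕ) (g : Fin k → Function.End (Fin m × Fin n))
    (hg : ∀ t, g t ∈ U)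
    (hprod : (List.ofFn g).reverse.prod = eijf r s id)
    (hmin : ∀ (k' : ℕ) (g' : Fin k' → Function.End (Fin m × Fin n)),
      (∀ t, g' t ∈ U) → (List.ofFn g').reverse.prod = eijf r s id → k ≤ k') :
    ∀ t : Fin k, ∃ (i j : Fin m) (f : Fin n → Fin n),
      i ≠ j ∧ Function.Bijective f ∧ g t = eijf i j f := by
  intro t
  obtain ⟨L₁, L₂, hL⟩ := List.append_of_mem (List.mem_ofFn.mpr ⟨t, rfl⟩ : g t ∈ List.ofFn g)
  have hmem : ∀ u ∈ L₁ ++ g t :: L₂, u ∈ U := by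
    rw [← hL]
    intro u hu
    obtain ⟨t', rfl⟩ := List.mem_ofFn.mp hu
    exact hg t'
  have hlen : k = L₁.length + (L₂.length + 1) := by
    simpa using congrArg List.length hL
  have he : L₂.reverse.prod * (g t * L₁.reverse.prod) = eijf r s id := by
    rw [← hprod, hL]
    simp
  have hBP : BP L₁.reverse.prod :=
    BP.list_prod _ fun u hu => (hU u (hmem u (by simp_all))).1
  refine exists_eq_eijf_of_factor (hU _ (hg t)).1 (hU _ (hg t)).2 hBP he fun hfix => ?_
  have hle := hmin (L₁ ++ L₂).length (L₁ ++ L₂).get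
    (fun t' => hmem _ (by
      have := List.get_mem (L₁ ++ L₂) t'
      rw [List.mem_append] at this ⊢
      exact this.imp_right (List.mem_cons_of_mem _)))
    (by rw [List.ofFn_get, List.reverse_append, List.prod_append, ← he, hfix])
  rw [List.length_append] at hle
  omega
end
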